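/- arXiv:2212.05650 — 2 statements merged into one kernel-verified Lean document; each statement's English description precedes it below -/
import Mathlib

section
/- In every subgame-perfect Nash equilibrium of the n-player P^{n−1}&C game, the realized payoff of player 1 equals max_{a∈A} ∑_{i=1}^n u_i(a) − ∑_{j=2}^n Avg_j, and the realized payoff of each player i ∈ {2,…,n} equals Avg_i. -/
open Finset

/-- Continuation play in the `P^{n-1}&C` game: the full sequence of the `n` posted
price vectors (indexed `0,…,n-1`, where index `j` stands for the paper's `p^{j+2}`),
given that the first `m` of them are fixed by the history `h` and all subsequent
price-setters follow the strategy `σ`. -/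
noncomputable def pcCont {A : Type*} (n : ℕ)
    (σ : (i : Fin n) → (Fin i.val → (A → ℝ)) → (A → ℝ))
    (m : ℕ) (h : Fin m → (A → ℝ)) (i : Fin n) : A → ℝ :=
  if hm : i.val < m then h ⟨i.val, hm⟩
  else σ i (fun j => pcCont n σ m h ⟨j.val, j.isLt.trans i.isLt⟩)
termination_by i.val
decreasing_by exact j.isLt

/-- Payoff of player `i` (0-indexed) in the `n`-player `P^{n-1}&C` game, given the
sequence `q` of the `n-1` posted price vectors (`q j` is the paper's `p^{j+2}`) and
the chosen option `a`: with `p^1 = p^{n+1} ≡ 0`, it is `u_i(a) − p^i(a) + p^{i+1}(a)`. -/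
noncomputable def pcPayoff {A : Type*} (n : ℕ) (u : Fin n → A → ℝ)
    (q : Fin (n - 1) → (A → ℝ)) (a : A) (i : Fin n) : ℝ :=
  u i a
    - (if h : 1 ≤ i.val then q ⟨i.val - 1, by have := i.isLt; omega⟩ a else 0)
    + (if h : i.val < n - 1 then q ⟨i.val, h⟩ a else 0)

/-- Subgame-perfect Nash equilibrium of the `n`-player `P^{n-1}&C` game: the
price-setters `i = 0,…,n-2` choose balanced price vectors, the last player's choice
is optimal after every history of balanced prices, and after every history of
balanced prices each price-setter's prescribed (balanced) price vector is optimal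
among balanced price vectors, given that all subsequent players follow the profile. -/
def pcSPNE {A : Type*} [Fintype A] (n : ℕ) (hn : 2 ≤ n) (u : Fin n → A → ℝ)
    (σ : (i : Fin (n - 1)) → (Fin i.val → (A → ℝ)) → (A → ℝ))
    (τ : (Fin (n - 1) → (A → ℝ)) → A) : Prop :=
  -- strategies select balanced price vectors
  (∀ (i : Fin (n - 1)) (h : Fin i.val → (A → ℝ)),
      (∀ j, ∑ a, h j a = 0) → ∑ a, σ i h a = 0) ∧
  -- the last player is optimal at every history
  (∀ q : Fin (n - 1) → (A → ℝ), (∀ j, ∑ a, q j a = 0) →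
      ∀ a : A,
        pcPayoff n u q a ⟨n - 1, by omega⟩ ≤
          pcPayoff n u q (τ q) ⟨n - 1, by omega⟩) ∧
  -- each price-setter is optimal at every history
  (∀ (i : Fin (n - 1)) (h : Fin i.val → (A → ℝ)), (∀ j, ∑ a, h j a = 0) →
      ∀ p : A → ℝ, (∑ a, p a = 0) →
        pcPayoff n u (pcCont (n - 1) σ (i.val + 1) (Fin.snoc h p))
            (τ (pcCont (n - 1) σ (i.val + 1) (Fin.snoc h p)))
            ⟨i.val, by have := i.isLt; omega⟩ ≤
        pcPayoff n u (pcCont (n - 1) σ i.val h)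
            (τ (pcCont (n - 1) σ i.val h))
            ⟨i.val, by have := i.isLt; omega⟩)


/-- Sum of the utilities of players `k, k+1, …`. -/
noncomputable def pcU {A : Type*} (n : ℕ) (u : Fin n → A → ℝ) (k : ℕ) (a : A) : ℝ :=
  ∑ i ∈ Finset.univ.filter (fun i : Fin n => k ≤ i.val), u i a

/-- Price vector paid by player `k` (zero outside the range). -/
noncomputable def pcExt {A : Type*} (n : ℕ) (q : Fin (n - 1) → (A → ℝ)) (k : ℕ) (a : A) : ℝ :=
  if h : 1 ≤ k ∧ k - 1 < n - 1 then q ⟨k - 1, h.2⟩ a else 0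

/-- Joint surplus of players `k, k+1, …`. -/
noncomputable def pcV {A : Type*} (n : ℕ) (u : Fin n → A → ℝ)
    (q : Fin (n - 1) → (A → ℝ)) (k : ℕ) (a : A) : ℝ :=
  pcU n u k a - pcExt n q k a

lemma pcU_succ {A : Type*} (n : ℕ) (u : Fin n → A → ℝ) (i : Fin n) (a : A) :
    pcU n u i.val a = u i a + pcU n u (i.val + 1) a := by
  unfold pcU
  have : (Finset.univ.filter (fun j : Fin n => i.val ≤ j.val)) =
      insert i (Finset.univ.filter (fun j : Fin n => i.val + 1 ≤ j.val)) := by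
    ext j
    simp only [Finset.mem_filter, Finset.mem_univ, true_and, Finset.mem_insert, Fin.ext_iff]
    omega
  rw [this, Finset.sum_insert]
  simp

lemma pcPayoff_eq {A : Type*} (n : ℕ) (u : Fin n → A → ℝ)
    (q : Fin (n - 1) → (A → ℝ)) (a : A) (i : Fin n) :
    pcPayoff n u q a i = pcV n u q i.val a - pcV n u q (i.val + 1) a := by
  have hi := i.isLt
  unfold pcV
  rw [pcU_succ]
  have h1 : pcExt n q i.val a =
      (if h : 1 ≤ i.val then q ⟨i.val - 1, by omega⟩ a else 0) := by
    unfold pcExt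
    by_cases h : 1 ≤ i.val
    · rw [dif_pos ⟨h, by omega⟩, dif_pos h]
    · rw [dif_neg (fun h' => h h'.1), dif_neg h]
  have h2 : pcExt n q (i.val + 1) a =
      (if h : i.val < n - 1 then q ⟨i.val, h⟩ a else 0) := by
    unfold pcExt
    by_cases h : i.val < n - 1
    · rw [dif_pos ⟨by omega, by omega⟩, dif_pos h]
      rfl
    · rw [dif_neg (fun h' => h (by omega)), dif_neg h]
  rw [h1, h2]
  unfold pcPayoff
  ring

lemma pcV_ge {A : Type*} (n : ℕ) (u : Fin n → A → ℝ)
    (q : Fin (n - 1) → (A → ℝ)) (k : ℕ) (hk : n ≤ k) (hn : 2 ≤ n) (a : A) :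
    pcU n u k a = 0 ∧ pcV n u q k a = 0 := by
  have h1 : pcU n u k a = 0 := by
    unfold pcU
    apply Finset.sum_eq_zero
    intro i hi
    have := i.isLt
    simp only [Finset.mem_filter, Finset.mem_univ, true_and] at hi
    omega
  refine ⟨h1, ?_⟩
  unfold pcV pcExt
  rw [h1, dif_neg (by omega)]
  simp

lemma pcCont_lt {A : Type*} (n : ℕ)
    (σ : (i : Fin n) → (Fin i.val → (A → ℝ)) → (A → ℝ))
    (m : ℕ) (h : Fin m → (A → ℝ)) (i : Fin n) (hi : i.val < m) :
    pcCont n σ m h i = h ⟨i.val, hi⟩ := by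
  rw [pcCont, dif_pos hi]

lemma pcCont_ge {A : Type*} (n : ℕ)
    (σ : (i : Fin n) → (Fin i.val → (A → ℝ)) → (A → ℝ))
    (m : ℕ) (h : Fin m → (A → ℝ)) (i : Fin n) (hi : ¬ i.val < m) :
    pcCont n σ m h i = σ i (fun j => pcCont n σ m h ⟨j.val, j.isLt.trans i.isLt⟩) := by
  rw [pcCont, dif_neg hi]

lemma pcCont_snoc {A : Type*} (n : ℕ)
    (σ : (i : Fin n) → (Fin i.val → (A → ℝ)) → (A → ℝ))
    (k : ℕ) (hk : k < n) (h : Fin k → (A → ℝ)) :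
    pcCont n σ (k + 1) (Fin.snoc (α := fun _ => A → ℝ) h (σ ⟨k, hk⟩ h)) = pcCont n σ k h := by
  have key : ∀ m : ℕ, ∀ hm : m < n,
      pcCont n σ (k + 1) (Fin.snoc (α := fun _ => A → ℝ) h (σ ⟨k, hk⟩ h)) ⟨m, hm⟩ =
        pcCont n σ k h ⟨m, hm⟩ := by
    intro m
    induction m using Nat.strong_induction_on with
    | _ m ih =>
      intro hm
      rcases lt_trichotomy m k with hlt | heq | hgt
      · rw [pcCont_lt _ _ _ _ _ (by dsimp only; omega), pcCont_lt _ _ _ _ _ (by simpa using hlt)]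
        simp [Fin.snoc, hlt]
      · subst heq
        rw [pcCont_lt _ _ _ _ _ (by simp), pcCont_ge _ _ _ _ _ (by simp)]
        have : (fun j : Fin m => pcCont n σ m h ⟨j.val, j.isLt.trans hm⟩) = h := by
          funext j
          rw [pcCont_lt _ _ _ _ _ (by simp)]
        simp only [this]
        simp [Fin.snoc]
      · rw [pcCont_ge _ _ _ _ _ (by dsimp only; omega), pcCont_ge _ _ _ _ _ (by dsimp only; omega)]
        congr 1
        funext j
        exact ih j.val j.isLt _
  funext i
  exact key i.val i.isLt

lemma pcExt_snoc_last {A : Type*} (n : ℕ)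
    (σ : (i : Fin (n - 1)) → (Fin i.val → (A → ℝ)) → (A → ℝ))
    (k : ℕ) (hk : k < n - 1) (h : Fin k → (A → ℝ)) (p : A → ℝ) (a : A) :
    pcExt n (pcCont (n - 1) σ (k + 1) (Fin.snoc (α := fun _ => A → ℝ) h p)) (k + 1) a = p a := by
  unfold pcExt
  rw [dif_pos ⟨by omega, by omega⟩, pcCont_lt _ _ _ _ _ (by simp)]
  simp [Fin.snoc]

lemma pcExt_snoc_prev {A : Type*} (n : ℕ)
    (σ : (i : Fin (n - 1)) → (Fin i.val → (A → ℝ)) → (A → ℝ))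
    (k : ℕ) (h : Fin k → (A → ℝ)) (p : A → ℝ) (a : A) :
    pcExt n (pcCont (n - 1) σ (k + 1) (Fin.snoc (α := fun _ => A → ℝ) h p)) k a =
      pcExt n (pcCont (n - 1) σ k h) k a := by
  unfold pcExt
  by_cases hk : 1 ≤ k ∧ k - 1 < n - 1
  · rw [dif_pos hk, dif_pos hk, pcCont_lt _ _ _ _ _ (by dsimp only; omega),
      pcCont_lt _ _ _ _ _ (by dsimp only; omega)]
    have : k - 1 < k := by omega
    simp [Fin.snoc, this]
  · rw [dif_neg hk, dif_neg hk]

/-- The backward-induction claim. -/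
lemma pc_claim {A : Type*} [Fintype A] [Nonempty A] (n : ℕ) (hn : 2 ≤ n)
    (u : Fin n → A → ℝ)
    (σ : (i : Fin (n - 1)) → (Fin i.val → (A → ℝ)) → (A → ℝ))
    (τ : (Fin (n - 1) → (A → ℝ)) → A)
    (hspne : pcSPNE n hn u σ τ) (k : ℕ) (hk : k ≤ n - 1) :
    ∀ h : Fin k → (A → ℝ), (∀ j, ∑ a, h j a = 0) →
      (∀ b, pcV n u (pcCont (n - 1) σ k h) k b ≤
        pcV n u (pcCont (n - 1) σ k h) k (τ (pcCont (n - 1) σ k h))) ∧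
      ∀ j, k < j → pcV n u (pcCont (n - 1) σ k h) j (τ (pcCont (n - 1) σ k h)) =
        (∑ a, pcU n u j a) / (Fintype.card A : ℝ) := by
  classical
  obtain ⟨hbal, hlast, hopt⟩ := hspne
  have hN : (0 : ℝ) < Fintype.card A := by exact_mod_cast Fintype.card_pos
  induction hk using Nat.decreasingInduction with
  | self =>
    intro h hh
    refine ⟨?_, ?_⟩
    · intro b
      have hq : ∀ j, ∑ a, pcCont (n - 1) σ (n - 1) h j a = 0 := by
        intro j
        rw [pcCont_lt _ _ _ _ _ j.isLt]
        exact hh _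
      have := hlast _ hq b
      rw [pcPayoff_eq, pcPayoff_eq, (pcV_ge n u _ (n - 1 + 1) (by omega) hn _).2,
        (pcV_ge n u _ (n - 1 + 1) (by omega) hn _).2] at this
      simpa using this
    · intro j hj
      rw [(pcV_ge n u _ j (by omega) hn _).2]
      simp [fun a => (pcV_ge n u (pcCont (n - 1) σ (n - 1) h) j (by omega) hn a).1]
  | of_succ k hk ih =>
    intro h hh
    have hkn : k < n - 1 := hk
    have hsn : ∀ p : A → ℝ, ∑ a, p a = 0 →
        ∀ j, ∑ a, (Fin.snoc (α := fun _ => A → ℝ) h p : Fin (k + 1) → (A → ℝ)) j a = 0 := by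
      intro p hp j
      refine Fin.lastCases ?_ (fun i => ?_) j
      · simpa using hp
      · simpa using hh i
    have hc := hbal ⟨k, hkn⟩ h hh
    have ihq := ih _ (hsn _ hc)
    have hext := pcExt_snoc_last n σ k hkn h (σ ⟨k, hkn⟩ h)
    rw [pcCont_snoc] at ihq
    simp only [pcCont_snoc] at hext
    have hopt' := hopt ⟨k, hkn⟩ h hh
    simp only [pcPayoff_eq] at hopt'
    set q := pcCont (n - 1) σ k h with hqdef
    obtain ⟨ih1, ih2⟩ := ihq
    set avg := (∑ a, pcU n u (k + 1) a) / (Fintype.card A : ℝ) with havg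
    have hlow : avg ≤ pcV n u q (k + 1) (τ q) := by
      rw [havg, div_le_iff₀ hN]
      have h1 : ∑ b, pcV n u q (k + 1) b = ∑ b, pcU n u (k + 1) b := by
        simp only [pcV, hext, Finset.sum_sub_distrib]
        rw [hc, sub_zero]
      rw [← h1]
      have := Finset.sum_le_card_nsmul Finset.univ (fun b => pcV n u q (k + 1) b) _
        (fun b _ => ih1 b)
      rw [Finset.card_univ, nsmul_eq_mul] at this
      linarith
    have hdev : ∀ b, pcV n u q k b - avg ≤ pcV n u q k (τ q) - pcV n u q (k + 1) (τ q) := by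
      intro b
      apply le_of_forall_pos_le_add
      intro ε hε
      let p : A → ℝ := fun x =>
        pcU n u (k + 1) x - avg - (if x = b then ε else 0) + ε / (Fintype.card A : ℝ)
      have hp : ∑ x, p x = 0 := by
        simp only [p, Finset.sum_add_distrib, Finset.sum_sub_distrib, Finset.sum_const,
          Finset.card_univ, nsmul_eq_mul, Finset.sum_ite_eq', Finset.mem_univ, if_true]
        rw [havg]
        field_simp
        ring
      have h1 := (ih _ (hsn p hp)).1
      have h2 := hopt' p hp
      have h3 := pcExt_snoc_last n σ k hkn h p
      have h4 := pcExt_snoc_prev n σ k h p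
      set q' := pcCont (n - 1) σ (k + 1) (Fin.snoc (α := fun _ => A → ℝ) h p) with hq'
      have hV : ∀ x, pcV n u q' (k + 1) x =
          avg + (if x = b then ε else 0) - ε / (Fintype.card A : ℝ) := by
        intro x
        simp only [pcV, h3, p]
        ring
      have hτ : τ q' = b := by
        by_contra hne
        have := h1 b
        rw [hV, hV, if_pos rfl, if_neg hne] at this
        linarith
      have h5 : pcV n u q' k b = pcV n u q k b := by
        simp only [pcV, h4, hqdef]
      have h6 : pcV n u q' k (τ q') - pcV n u q' (k + 1) (τ q') ≤
          pcV n u q k (τ q) - pcV n u q (k + 1) (τ q) := h2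
      rw [hτ, h5, hV, if_pos rfl] at h6
      have : 0 < ε / (Fintype.card A : ℝ) := by positivity
      linarith
    have heq : pcV n u q (k + 1) (τ q) = avg := by
      have := hdev (τ q)
      linarith
    refine ⟨fun b => ?_, fun j hj => ?_⟩
    · have := hdev b
      linarith
    · rcases Nat.lt_or_ge (k + 1) j with h' | h'
      · exact ih2 j h'
      · obtain rfl : j = k + 1 := by omega
        exact heq

/-- in every SPNE of the `n`-player `P^{n-1}&C` game, player 1's realized
payoff equals `max_a ∑ i u_i(a) − ∑_{j=2}^n Avg_j`, and each player `i ∈ {2,…,n}`'s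
realized payoff equals `Avg_i`. -/
theorem pc_nplayer_spne_payoffs
    {A : Type*} [Fintype A] [Nonempty A] (n : ℕ) (hn : 2 ≤ n)
    (u : Fin n → A → ℝ)
    (σ : (i : Fin (n - 1)) → (Fin i.val → (A → ℝ)) → (A → ℝ))
    (τ : (Fin (n - 1) → (A → ℝ)) → A)
    (hspne : pcSPNE n hn u σ τ) :
    pcPayoff n u (pcCont (n - 1) σ 0 Fin.elim0)
        (τ (pcCont (n - 1) σ 0 Fin.elim0)) ⟨0, by omega⟩ =
      (Finset.univ.sup' Finset.univ_nonempty fun a => ∑ i, u i a)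
        - ∑ j ∈ Finset.univ.filter (fun j : Fin n => 1 ≤ j.val),
            (∑ a, u j a) / (Fintype.card A : ℝ) ∧
    ∀ i : Fin n, 1 ≤ i.val →
      pcPayoff n u (pcCont (n - 1) σ 0 Fin.elim0)
          (τ (pcCont (n - 1) σ 0 Fin.elim0)) i =
        (∑ a, u i a) / (Fintype.card A : ℝ) := by
  obtain ⟨h1, h2⟩ := pc_claim n hn u σ τ hspne 0 (by omega) Fin.elim0 (fun j => j.elim0)
  set q := pcCont (n - 1) σ 0 Fin.elim0 with hq
  have hV0 : ∀ b, pcV n u q 0 b = ∑ i, u i b := by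
    intro b
    simp [pcV, pcU, pcExt]
  refine ⟨?_, fun i hi => ?_⟩
  · rw [pcPayoff_eq]
    simp only [zero_add]
    rw [h2 1 (by omega)]
    congr 1
    · apply le_antisymm
      · rw [hV0]
        exact Finset.le_sup' (fun a => ∑ i, u i a) (Finset.mem_univ (τ q))
      · apply Finset.sup'_le
        intro b _
        rw [← hV0]
        exact h1 b
    · rw [← Finset.sum_div]
      unfold pcU
      rw [Finset.sum_comm]
  · rw [pcPayoff_eq, h2 _ (by omega), h2 _ (by omega), ← sub_div, ← Finset.sum_sub_distrib]
    congr 1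
    apply Finset.sum_congr rfl
    intro a _
    rw [pcU_succ]
    ring
end

section
/- In every Nash equilibrium of the bidding game preceding Price & Choose, the winning bid equals b* = ((n−1)/n)·η; consequently every player i's expected equilibrium payoff is U_i = Avg_i + η/n, so that U_i − U_j = Avg_i − Avg_j for all players i, j. -/
open Finset

/-- `η = max(u) − ∑_i Avg_i` for the bidding game preceding Price & Choose. -/
noncomputable def bidEta {A : Type*} [Fintype A] [Nonempty A] (n : ℕ)
    (u : Fin n → A → ℝ) : ℝ :=
  (Finset.univ.sup' Finset.univ_nonempty fun a : A => ∑ j, u j a)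
    - ∑ j, (∑ a, u j a) / (Fintype.card A : ℝ)

/-- Expected payoff of player `i` in the bidding game preceding Price & Choose,
at the bid profile `b`: with `M = max_j b_j` and `W = {j : b_j = M}`,
`π_i(b) = Avg_i + (1/|W|)(η − M) + ((|W|−1)/|W|)·M/(n−1)` if `i ∈ W`, and
`π_i(b) = Avg_i + M/(n−1)` otherwise. -/
noncomputable def bidPayoff {A : Type*} [Fintype A] [Nonempty A] (n : ℕ) (hn : 2 ≤ n)
    (u : Fin n → A → ℝ) (b : Fin n → ℝ) (i : Fin n) : ℝ :=
  haveI : Nonempty (Fin n) := Fin.pos_iff_nonempty.mp (by omega)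
  let Avg : Fin n → ℝ := fun j => (∑ a, u j a) / (Fintype.card A : ℝ)
  let M : ℝ := Finset.univ.sup' Finset.univ_nonempty b
  let W : Finset (Fin n) := Finset.univ.filter (fun j => b j = M)
  if i ∈ W then
    Avg i + (1 / (W.card : ℝ)) * (bidEta n u - M)
      + (((W.card : ℝ) - 1) / (W.card : ℝ)) * (M / ((n : ℝ) - 1))
  else Avg i + M / ((n : ℝ) - 1)

/-- Nash equilibrium of the bidding game: all bids are nonnegative and no player can
strictly increase her expected payoff by unilaterally changing her bid within `[0, ∞)`. -/
def bidNE {A : Type*} [Fintype A] [Nonempty A] (n : ℕ) (hn : 2 ≤ n)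
    (u : Fin n → A → ℝ) (b : Fin n → ℝ) : Prop :=
  (∀ i, 0 ≤ b i) ∧
  ∀ (i : Fin n) (c : ℝ), 0 ≤ c →
    bidPayoff n hn u (Function.update b i c) i ≤ bidPayoff n hn u b i

lemma bid_sup_eq {n : ℕ} [Nonempty (Fin n)] (b : Fin n → ℝ) (M : ℝ) (hM : ∀ j, b j ≤ M)
    (k : Fin n) (hk : b k = M) : Finset.univ.sup' Finset.univ_nonempty b = M := by
  apply le_antisymm
  · exact Finset.sup'_le _ _ fun j _ => hM j
  · rw [← hk]; exact Finset.le_sup' b (Finset.mem_univ k)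

lemma bidPayoff_eq {A : Type*} [Fintype A] [Nonempty A] (n : ℕ) (hn : 2 ≤ n)
    (u : Fin n → A → ℝ) (b : Fin n → ℝ) (i : Fin n) (M : ℝ) (hM : ∀ j, b j ≤ M)
    (k : Fin n) (hk : b k = M) :
    bidPayoff n hn u b i = if b i = M then
      (∑ a, u i a) / (Fintype.card A : ℝ)
        + (1 / ((Finset.univ.filter (fun j => b j = M)).card : ℝ)) * (bidEta n u - M)
        + ((((Finset.univ.filter (fun j => b j = M)).card : ℝ) - 1) /
          ((Finset.univ.filter (fun j => b j = M)).card : ℝ)) * (M / ((n : ℝ) - 1))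
      else (∑ a, u i a) / (Fintype.card A : ℝ) + M / ((n : ℝ) - 1) := by
  haveI : Nonempty (Fin n) := ⟨k⟩
  have h := bid_sup_eq b M hM k hk
  simp only [bidPayoff, h, Finset.mem_filter, Finset.mem_univ, true_and]

lemma bidPayoff_sole {A : Type*} [Fintype A] [Nonempty A] (n : ℕ) (hn : 2 ≤ n)
    (u : Fin n → A → ℝ) (b : Fin n → ℝ) (i : Fin n) (hM : ∀ j, j ≠ i → b j < b i) :
    bidPayoff n hn u b i = (∑ a, u i a) / (Fintype.card A : ℝ) + (bidEta n u - b i) := by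
  rw [bidPayoff_eq n hn u b i (b i) (fun j => ?_) i rfl]
  · have : (Finset.univ.filter (fun j => b j = b i)) = {i} := by
      ext j
      simp only [Finset.mem_filter, Finset.mem_univ, true_and, Finset.mem_singleton]
      constructor
      · intro h
        by_contra hj
        exact absurd h (hM j hj).ne
      · rintro rfl; rfl
    simp [this]
  · by_cases hj : j = i
    · rw [hj]
    · exact (hM j hj).le

lemma bidEta_nonneg {A : Type*} [Fintype A] [Nonempty A] (n : ℕ)
    (u : Fin n → A → ℝ) : 0 ≤ bidEta n u := by
  unfold bidEta
  rw [← Finset.sum_div, Finset.sum_comm, sub_nonneg, div_le_iff₀ (by positivity), mul_comm,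
    ← nsmul_eq_mul]
  exact Finset.sum_le_card_nsmul _ _ _ fun a ha =>
    Finset.le_sup' (fun a : A => ∑ j, u j a) ha

/-- in every Nash equilibrium of the bidding game, the winning bid
equals `b* = ((n−1)/n)·η`, every player `i`'s expected equilibrium payoff is
`U_i = Avg_i + η/n`, and hence `U_i − U_j = Avg_i − Avg_j` for all `i, j`. -/
theorem bid_equilibrium_payoffs
    {A : Type*} [Fintype A] [Nonempty A] (n : ℕ) (hn : 2 ≤ n)
    (u : Fin n → A → ℝ) (b : Fin n → ℝ) (hne : bidNE n hn u b) :
    haveI : Nonempty (Fin n) := Fin.pos_iff_nonempty.mp (by omega)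
    (Finset.univ.sup' Finset.univ_nonempty b = (((n : ℝ) - 1) / (n : ℝ)) * bidEta n u) ∧
    (∀ i : Fin n,
      bidPayoff n hn u b i =
        (∑ a, u i a) / (Fintype.card A : ℝ) + bidEta n u / (n : ℝ)) ∧
    (∀ i j : Fin n,
      bidPayoff n hn u b i - bidPayoff n hn u b j =
        (∑ a, u i a) / (Fintype.card A : ℝ) - (∑ a, u j a) / (Fintype.card A : ℝ)) := by
  haveI : Nonempty (Fin n) := Fin.pos_iff_nonempty.mp (by omega)
  obtain ⟨h0, hdev⟩ := hne
  obtain ⟨k, -, hk⟩ := Finset.exists_mem_eq_sup' (Finset.univ_nonempty (α := Fin n)) b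
  have hmax : ∀ j, b j ≤ b k := fun j => hk ▸ Finset.le_sup' b (Finset.mem_univ j)
  have heta := bidEta_nonneg n u
  have hn2 : (2 : ℝ) ≤ n := by exact_mod_cast hn
  have hm : (0 : ℝ) < (n : ℝ) - 1 := by linarith
  have hn0 : (0 : ℝ) < n := by linarith
  have hpay := fun i => bidPayoff_eq n hn u b i (b k) hmax k rfl
  set η := bidEta n u with hη
  set w := (Finset.univ.filter (fun j => b j = b k)).card with hw
  have hkw : k ∈ Finset.univ.filter (fun j => b j = b k) := by simp
  have hw1 : 1 ≤ w := Finset.card_pos.mpr ⟨k, hkw⟩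
  have hw1' : (1 : ℝ) ≤ w := by exact_mod_cast hw1
  have hw0 : (0 : ℝ) < w := by linarith
  have hbs : η - ((n : ℝ) - 1) / n * η = η / n := by field_simp; ring
  have hM : b k = (((n : ℝ) - 1) / (n : ℝ)) * η := by
    rcases lt_trichotomy (b k) ((((n : ℝ) - 1) / (n : ℝ)) * η) with hlt | heq | hgt
    · exfalso
      -- some player has payoff at most `Avg + η / n`
      have hlow : ∃ i, bidPayoff n hn u b i ≤ (∑ a, u i a) / (Fintype.card A : ℝ) + η / n := by
        by_cases hl : ∃ i, b i ≠ b k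
        · obtain ⟨i, hi⟩ := hl
          refine ⟨i, ?_⟩
          rw [hpay i, if_neg hi]
          have : b k / ((n : ℝ) - 1) ≤ η / n := by
            rw [div_le_iff₀ hm]
            calc b k ≤ _ := hlt.le
              _ = _ := by ring
          linarith
        · push Not at hl
          refine ⟨k, ?_⟩
          have hwn : w = n := by
            rw [hw, Finset.filter_true_of_mem (fun j _ => hl j)]; simp
          rw [hpay k, if_pos rfl, hwn]
          apply le_of_eq
          field_simp
          ring
      obtain ⟨i, hi⟩ := hlow
      obtain ⟨c, hc1, hc2⟩ := exists_between hlt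
      have h1 := hdev i c ((h0 k).trans hc1.le)
      rw [bidPayoff_sole n hn u _ i (fun j hj => by
        simpa [hj] using (hmax j).trans_lt hc1)] at h1
      simp only [Function.update_self] at h1
      linarith
    · exact heq
    · exfalso
      have hb0 : 0 ≤ (((n : ℝ) - 1) / (n : ℝ)) * η := by positivity
      by_cases hl : ∃ l, l ≠ k ∧ b l = b k
      · obtain ⟨l, hlk, hl⟩ := hl
        have h1 := hdev k 0 le_rfl
        rw [hpay k, if_pos rfl, bidPayoff_eq n hn u _ k (b k) (fun j => ?_) l (by simp [hlk, hl]),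
          if_neg (by simp; linarith)] at h1
        · have h2 : η - b k < b k / ((n : ℝ) - 1) := by
            rw [lt_div_iff₀ hm]
            have : ((n : ℝ) - 1) * η < b k * n := by
              rwa [div_mul_eq_mul_div, div_lt_iff₀ hn0] at hgt
            nlinarith
          have h3 : (1 / (w : ℝ)) * (η - b k) < (1 / (w : ℝ)) * (b k / ((n : ℝ) - 1)) :=
            mul_lt_mul_of_pos_left h2 (by positivity)
          have h4 : (1 / (w : ℝ)) * (b k / ((n : ℝ) - 1))
            + ((w : ℝ) - 1) / w * (b k / ((n : ℝ) - 1)) = b k / ((n : ℝ) - 1) := by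
            field_simp; ring
          linarith
        · by_cases hj : j = k
          · subst hj; simpa using h0 j
          · simpa [hj] using hmax j
      · push Not at hl
        have hlt : ∀ j, j ≠ k → b j < b k := fun j hj => lt_of_le_of_ne (hmax j) (hl j hj)
        have hne' : (Finset.univ.erase k).Nonempty := by
          rw [← Finset.card_pos, Finset.card_erase_of_mem (Finset.mem_univ k)]
          simp; omega
        obtain ⟨l, hlm, hls⟩ := Finset.exists_max_image _ b hne'
        obtain ⟨c, hc1, hc2⟩ := exists_between (hlt l (Finset.ne_of_mem_erase hlm))
        have h1 := hdev k c ((h0 l).trans hc1.le)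
        rw [bidPayoff_sole n hn u b k hlt, bidPayoff_sole n hn u _ k (fun j hj => by
          simpa [hj] using (hls j (by simp [hj])).trans_lt hc1)] at h1
        simp only [Function.update_self] at h1
        linarith
  have hall : ∀ i, bidPayoff n hn u b i = (∑ a, u i a) / (Fintype.card A : ℝ) + η / n := by
    intro i
    rw [hpay i, hM]
    split_ifs
    · field_simp
      ring
    · field_simp
  refine ⟨hk.trans hM, hall, fun i j => ?_⟩
  rw [hall i, hall j]; ring
end
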